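/- Let 0 < p < 1. There exists a constant c_p > 0, depending only on p and λ = sup_k m_k, such that for every martingale f ∈ H_p the weighted maximal operator of partial sums satisfies ‖ sup_{n∈ℕ} |S_n f| / (n+1)^{1/p−1} ‖_{L_p(μ)} ≤ c_p · ‖f‖_{H_p}. -/

import Mathlib

open MeasureTheory Complex Finset
open scoped BigOperators ENNReal NNReal

noncomputable section

instance (n : ℕ) : MeasurableSpace (ZMod n) := ⊤

/-- The Vilenkin group determined by the generating sequence `m`. -/
abbrev Gm (m : ℕ → ℕ) : Type := ∀ _k : ℕ, ZMod (m _k)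

namespace Vilenkin

variable (m : ℕ → ℕ)

/-- The generalized powers `M_0 = 1`, `M_{k+1} = m_k · M_k`. -/
def M : ℕ → ℕ
  | 0 => 1
  | k + 1 => m k * M k

/-- The `j`-th digit `n_j` of `n` in the generalized number system based on `m`. -/
def digit (n j : ℕ) : ℕ := n / M m j % m j

/-- `|n|`, the index of the highest nonzero digit of `n`. -/
def hi (n : ℕ) : ℕ := Nat.findGreatest (fun j => digit m n j ≠ 0) n

/-- `⟨n⟩`, the index of the lowest nonzero digit of `n`. -/
def lo (n : ℕ) : ℕ := sInf {j | digit m n j ≠ 0}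

/-- The generalized Rademacher functions `r_k(x) = exp(2πi x_k / m_k)`. -/
def rad (k : ℕ) (x : Gm m) : ℂ :=
  Complex.exp (2 * Real.pi * Complex.I * ((x k).val : ℂ) / (m k : ℂ))

/-- The Vilenkin functions `ψ_n = ∏_k r_k^{n_k}`. -/
def vil (n : ℕ) (x : Gm m) : ℂ :=
  ∏ k ∈ Finset.range (n + 1), rad m k x ^ digit m n k

/-- The Dirichlet kernels `D_n = ∑_{k=0}^{n-1} ψ_k`. -/
def D (n : ℕ) (x : Gm m) : ℂ := ∑ k ∈ Finset.range n, vil m k x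

/-- The Fejér kernels `K_n = (1/n) ∑_{k=1}^{n} D_k`. -/
def K (n : ℕ) (x : Gm m) : ℂ := (n : ℂ)⁻¹ * ∑ k ∈ Finset.range n, D m (k + 1) x

/-- The Nörlund kernels `F_n = (1/Q_n) ∑_{k=1}^{n} q_{n-k} D_k` where
`Q_n = ∑_{k=0}^{n-1} q_k`. -/
def FK (q : ℕ → ℝ) (n : ℕ) (x : Gm m) : ℂ :=
  ((∑ k ∈ Finset.range n, q k : ℝ) : ℂ)⁻¹ *
    ∑ k ∈ Finset.range n, (q (n - (k + 1)) : ℂ) * D m (k + 1) x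

/-- The cylinder subgroup `I_n = {x : x_0 = … = x_{n-1} = 0}`. -/
def I (n : ℕ) : Set (Gm m) := {x | ∀ k < n, x k = 0}

/-- The cylinder of length `n` around `x`. -/
def cylAt (n : ℕ) (x : Gm m) : Set (Gm m) := {y | ∀ k < n, y k = x k}

/-- `μ` is the normalized Haar measure of `G_m`: the (unique) Borel probability
measure giving each cylinder of length `n` measure `1 / M_n`. -/
def IsHaar (μ : Measure (Gm m)) : Prop :=
  ∀ (n : ℕ) (x : Gm m), μ (cylAt m n x) = (M m n : ℝ≥0∞)⁻¹

/-- A martingale with respect to the filtration `(ℱ_n)` on `G_m`, where `ℱ_n` is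
generated by the first `n` coordinates: each `f n` is integrable and depends only
on the first `n` coordinates, and the conditional expectation of `f N` with
respect to `ℱ_n` (which under the Haar measure is given by averaging over the
cylinders of length `n`) equals `f n` for `n ≤ N`. -/
structure IsMartingale (μ : Measure (Gm m)) (f : ℕ → Gm m → ℂ) : Prop where
  integrable : ∀ n, Integrable (f n) μ
  adapted : ∀ (n : ℕ) (x y : Gm m), (∀ k < n, x k = y k) → f n x = f n y
  mart : ∀ n N : ℕ, n ≤ N → ∀ x : Gm m,
    f n x = (M m n : ℂ) * ∫ t in cylAt m n x, f N t ∂μ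

/-- The Vilenkin–Fourier coefficients of a martingale:
`f̂(i) = lim_k ∫ f^(k) conj(ψ_i) dμ`; for a martingale these integrals are
constant as soon as `M_k > i`, in particular from `k = i + 1` on. -/
def coeff (μ : Measure (Gm m)) (f : ℕ → Gm m → ℂ) (i : ℕ) : ℂ :=
  ∫ x, f (i + 1) x * (starRingEnd ℂ) (vil m i x) ∂μ

/-- The partial sums `S_n f = ∑_{k=0}^{n-1} f̂(k) ψ_k`. -/
def S (μ : Measure (Gm m)) (f : ℕ → Gm m → ℂ) (n : ℕ) (x : Gm m) : ℂ :=
  ∑ k ∈ Finset.range n, coeff m μ f k * vil m k x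

/-- The Fejér means `σ_n f = (1/n) ∑_{k=1}^{n} S_k f`. -/
def sigma (μ : Measure (Gm m)) (f : ℕ → Gm m → ℂ) (n : ℕ) (x : Gm m) : ℂ :=
  (n : ℂ)⁻¹ * ∑ k ∈ Finset.range n, S m μ f (k + 1) x

/-- The Nörlund means `t_n f = (1/Q_n) ∑_{k=1}^{n} q_{n-k} S_k f`. -/
def T (μ : Measure (Gm m)) (q : ℕ → ℝ) (f : ℕ → Gm m → ℂ) (n : ℕ) (x : Gm m) : ℂ :=
  ((∑ k ∈ Finset.range n, q k : ℝ) : ℂ)⁻¹ *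
    ∑ k ∈ Finset.range n, (q (n - (k + 1)) : ℂ) * S m μ f (k + 1) x

/-- The martingale maximal function `f* = sup_n |f^(n)|`. -/
def mstar (f : ℕ → Gm m → ℂ) (x : Gm m) : ℝ≥0∞ := ⨆ n, (‖f n x‖₊ : ℝ≥0∞)

/-- The `L_p`-type quasi-norm `(∫ g^p dμ)^{1/p}` of an `ℝ≥0∞`-valued function. -/
def eLp (μ : Measure (Gm m)) (p : ℝ) (g : Gm m → ℝ≥0∞) : ℝ≥0∞ :=
  (∫⁻ x, g x ^ p ∂μ) ^ (1 / p)

/-- Membership in the martingale Hardy space `H_p`: `‖f‖_{H_p} = ‖f*‖_{L_p} < ∞`. -/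
def MemHp (μ : Measure (Gm m)) (p : ℝ) (f : ℕ → Gm m → ℂ) : Prop :=
  eLp m μ p (mstar m f) ≠ ⊤

/-- The weak-`L_p` quasi-norm `sup_{t>0} t · μ(g > t)^{1/p}`. -/
def wLp (μ : Measure (Gm m)) (p : ℝ) (g : Gm m → ℝ≥0∞) : ℝ≥0∞ :=
  ⨆ t : ℝ≥0, (t : ℝ≥0∞) * μ {x | (t : ℝ≥0∞) < g x} ^ (1 / p)

end Vilenkin

namespace Vilenkin

variable {m}

lemma M_pos (hm : ∀ k, 2 ≤ m k) (n : ℕ) : 0 < M m n := by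
  induction n with
  | zero => simp [M]
  | succ k ih => exact Nat.mul_pos (by linarith [hm k]) ih

lemma two_pow_le_M (hm : ∀ k, 2 ≤ m k) (n : ℕ) : 2 ^ n ≤ M m n := by
  induction n with
  | zero => simp [M]
  | succ k ih =>
    rw [pow_succ', M]
    exact Nat.mul_le_mul (hm k) ih

lemma lt_M_self (hm : ∀ k, 2 ≤ m k) (n : ℕ) : n < M m n :=
  Nat.lt_two_pow_self.trans_le (two_pow_le_M hm n)

lemma M_dvd {i j : ℕ} (h : i ≤ j) : M m i ∣ M m j := by
  induction j, h using Nat.le_induction with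
  | base => exact dvd_rfl
  | succ k _ ih => exact ih.trans (Dvd.intro_left _ rfl)

lemma digit_mul_add (hm : ∀ k, 2 ≤ m k) {i N : ℕ} (h : i < N) (a r : ℕ) :
    digit m (a * M m N + r) i = digit m r i := by
  obtain ⟨c, hc⟩ : M m (i + 1) ∣ M m N := M_dvd h
  have e : a * M m N + r = r + M m i * (m i * (c * a)) := by
    rw [hc, M]; ring
  rw [digit, digit, e, Nat.add_mul_div_left _ _ (M_pos hm i), Nat.add_mul_mod_self_left]

lemma digit_mul_add_self {a r N : ℕ} (ha : a < m N) (hr : r < M m N) :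
    digit m (a * M m N + r) N = a := by
  rw [digit, add_comm, Nat.add_mul_div_right _ _ (by omega), Nat.div_eq_of_lt hr, zero_add,
    Nat.mod_eq_of_lt ha]

lemma digit_eq_zero (hm : ∀ k, 2 ≤ m k) {k N i : ℕ} (hk : k < M m N) (hi : N ≤ i) :
    digit m k i = 0 := by
  rw [digit, Nat.div_eq_of_lt (hk.trans_le (Nat.le_of_dvd (M_pos hm i) (M_dvd hi))), Nat.zero_mod]

variable (m) in
/-- The product `∏_{i<N} w_i^{k_i}` over the digits `k_i` of `k`. -/
def digitProd (w : ℕ → ℂ) (N k : ℕ) : ℂ := ∏ i ∈ range N, w i ^ digit m k i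

lemma digitProd_eq_of_le (hm : ∀ k, 2 ≤ m k) (w : ℕ → ℂ) {N N' k : ℕ} (hN : N ≤ N')
    (hk : k < M m N) : digitProd m w N k = digitProd m w N' k := by
  refine Finset.prod_subset (by simpa using hN) fun i _ hi => ?_
  rw [digit_eq_zero hm hk (by simpa using hi), pow_zero]

lemma vil_eq_digitProd (hm : ∀ k, 2 ≤ m k) {N k : ℕ} (hk : k < M m N) (x : Gm m) :
    vil m k x = digitProd m (fun i => rad m i x) N k := by
  have hk' : k < M m (k + 1) := (Nat.lt_succ_self k).trans (lt_M_self hm _)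
  change digitProd m (fun i => rad m i x) (k + 1) k = _
  rcases le_total (k + 1) N with h | h
  · exact digitProd_eq_of_le hm _ h hk'
  · exact (digitProd_eq_of_le hm _ h hk).symm

lemma digitProd_succ (hm : ∀ k, 2 ≤ m k) (w : ℕ → ℂ) {N a r : ℕ} (ha : a < m N)
    (hr : r < M m N) :
    digitProd m w (N + 1) (a * M m N + r) = w N ^ a * digitProd m w N r := by
  rw [digitProd, Finset.prod_range_succ, digit_mul_add_self ha hr, mul_comm, digitProd]
  congr 1
  refine Finset.prod_congr rfl fun i hi => ?_
  rw [digit_mul_add hm (Finset.mem_range.1 hi)]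

lemma sum_digitProd_mul (hm : ∀ k, 2 ≤ m k) (w : ℕ → ℂ) (N : ℕ) {q : ℕ} (hq : q ≤ m N) :
    ∑ k ∈ range (q * M m N), digitProd m w (N + 1) k =
      (∑ a ∈ range q, w N ^ a) * ∑ k ∈ range (M m N), digitProd m w N k := by
  induction q with
  | zero => simp
  | succ q ih =>
    rw [add_mul, one_mul, Finset.sum_range_add, ih (by omega), Finset.sum_range_succ, add_mul]
    congr 1
    rw [Finset.mul_sum]
    exact Finset.sum_congr rfl fun r hr => digitProd_succ hm w (by omega) (Finset.mem_range.1 hr)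

open Classical in
lemma norm_sum_digitProd_M_le (hm : ∀ k, 2 ≤ m k) {w : ℕ → ℂ} (hw : ∀ i, w i ^ m i = 1) (N : ℕ) :
    ‖∑ k ∈ range (M m N), digitProd m w N k‖ ≤
      if ∀ i < N, w i = 1 then (M m N : ℝ) else 0 := by
  induction N with
  | zero => simp [M, digitProd]
  | succ N ih =>
    rw [M, sum_digitProd_mul hm w N le_rfl, norm_mul]
    by_cases h1 : w N = 1
    · have e : (∀ i < N + 1, w i = 1) ↔ ∀ i < N, w i = 1 := by
        simp only [Nat.forall_lt_succ_right, h1, and_true]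
      simp only [h1, e]
      refine (mul_le_mul_of_nonneg_left ih (norm_nonneg _)).trans ?_
      split_ifs <;> simp
    · have : ∑ a ∈ range (m N), w N ^ a = 0 := by
        rw [geom_sum_eq h1, hw, sub_self, zero_div]
      rw [this]
      simp only [norm_zero, zero_mul]
      split_ifs <;> positivity

open Classical in
/-- The pointwise bound `lam * ∑_{j<N} M_j 1_{I_j}` for Dirichlet kernels. -/
lemma norm_sum_digitProd_le (hm : ∀ k, 2 ≤ m k) {lam : ℕ} (hlam : ∀ k, m k ≤ lam) {w : ℕ → ℂ}
    (hw : ∀ i, w i ^ m i = 1) (hw1 : ∀ i, ‖w i‖ = 1) (N : ℕ) : ∀ n < M m N,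
    ‖∑ k ∈ range n, digitProd m w N k‖ ≤
      lam * ∑ j ∈ range N, if ∀ i < j, w i = 1 then (M m j : ℝ) else 0 := by
  induction N with
  | zero => intro n hn; simp [M] at hn; simp [hn]
  | succ N ih =>
    intro n hn
    have hr : n % M m N < M m N := Nat.mod_lt _ (M_pos hm N)
    have hq : n / M m N < m N := Nat.div_lt_of_lt_mul (by rwa [M, mul_comm] at hn)
    rw [← Nat.div_add_mod' n (M m N), Finset.sum_range_add, sum_digitProd_mul hm w N hq.le,
      Finset.sum_congr rfl fun r hr' =>
        digitProd_succ hm w hq ((Finset.mem_range.1 hr').trans hr), ← Finset.mul_sum]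
    refine (norm_add_le _ _).trans ?_
    rw [norm_mul, norm_mul, norm_pow, hw1, one_pow, one_mul, Finset.sum_range_succ, mul_add,
      add_comm]
    refine add_le_add (ih _ hr) (mul_le_mul ?_ (norm_sum_digitProd_M_le hm hw N)
      (norm_nonneg _) (by positivity))
    calc ‖∑ a ∈ range (n / M m N), w N ^ a‖ ≤ ∑ a ∈ range (n / M m N), ‖w N ^ a‖ :=
          norm_sum_le _ _
      _ = (n / M m N : ℕ) := by simp [hw1]
      _ ≤ lam := by exact_mod_cast hq.le.trans (hlam N)

lemma rad_eq_pow (k : ℕ) (x : Gm m) :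
    rad m k x = Complex.exp (2 * Real.pi * Complex.I / m k) ^ (x k).val := by
  rw [rad, ← Complex.exp_nat_mul]
  congr 1
  ring

lemma norm_rad (k : ℕ) (x : Gm m) : ‖rad m k x‖ = 1 := by
  have : 2 * Real.pi * Complex.I * ((x k).val : ℂ) / (m k : ℂ) =
      ((2 * Real.pi * (x k).val / m k : ℝ) : ℂ) * Complex.I := by
    push_cast; ring
  rw [rad, this, Complex.norm_exp_ofReal_mul_I]

lemma rad_pow (hm : ∀ k, 2 ≤ m k) (k : ℕ) (x : Gm m) : rad m k x ^ m k = 1 := by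
  have := (Complex.isPrimitiveRoot_exp (m k) (by have := hm k; omega)).pow_eq_one
  rw [rad_eq_pow, pow_right_comm, this, one_pow]

lemma eq_of_rad_mul_conj_eq_one (hm : ∀ k, 2 ≤ m k) (k : ℕ) (x t : Gm m)
    (h : rad m k x * (starRingEnd ℂ) (rad m k t) = 1) : t k = x k := by
  have hk : m k ≠ 0 := by have := hm k; omega
  have : NeZero (m k) := ⟨hk⟩
  have h2 : rad m k x = rad m k t := by
    have h3 : rad m k t * (starRingEnd ℂ) (rad m k t) = 1 := by
      rw [Complex.mul_conj, Complex.normSq_eq_norm_sq, norm_rad]; simp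
    have h4 : (starRingEnd ℂ) (rad m k t) ≠ 0 := fun h0 => by simp [h0] at h3
    exact mul_right_cancel₀ h4 (h.trans h3.symm)
  rw [rad_eq_pow, rad_eq_pow] at h2
  exact (ZMod.val_injective _ ((Complex.isPrimitiveRoot_exp (m k) hk).pow_inj
    (ZMod.val_lt _) (ZMod.val_lt _) h2)).symm

lemma norm_vil (k : ℕ) (x : Gm m) : ‖vil m k x‖ = 1 := by
  simp [vil, norm_prod, norm_rad]

lemma vil_congr (hm : ∀ k, 2 ≤ m k) {N k : ℕ} (hk : k < M m N) (x y : Gm m)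
    (h : ∀ i < N, x i = y i) : vil m k x = vil m k y := by
  rw [vil_eq_digitProd hm hk, vil_eq_digitProd hm hk]
  refine Finset.prod_congr rfl fun i hi => ?_
  simp only [rad, h i (Finset.mem_range.1 hi)]

open Classical in
lemma norm_kernel_le (hm : ∀ k, 2 ≤ m k) {lam : ℕ} (hlam : ∀ k, m k ≤ lam) {n N : ℕ}
    (hn : n < M m N) (x t : Gm m) :
    ‖∑ k ∈ range n, (starRingEnd ℂ) (vil m k t) * vil m k x‖ ≤
      lam * ∑ j ∈ range N, if t ∈ cylAt m j x then (M m j : ℝ) else 0 := by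
  set w : ℕ → ℂ := fun i => rad m i x * (starRingEnd ℂ) (rad m i t) with hw
  have e : ∀ k ∈ range n, (starRingEnd ℂ) (vil m k t) * vil m k x = digitProd m w N k := by
    intro k hk
    have hk' := (Finset.mem_range.1 hk).trans hn
    rw [vil_eq_digitProd hm hk', vil_eq_digitProd hm hk', digitProd, digitProd, digitProd,
      map_prod, ← Finset.prod_mul_distrib]
    refine Finset.prod_congr rfl fun i _ => ?_
    rw [hw, mul_pow, map_pow, mul_comm]
  rw [Finset.sum_congr rfl e]
  refine (norm_sum_digitProd_le hm hlam (fun i => ?_) (fun i => ?_) N n hn).trans ?_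
  · rw [hw, mul_pow, ← map_pow, rad_pow hm, rad_pow hm]; simp
  · rw [hw, norm_mul, RCLike.norm_conj, norm_rad, norm_rad, one_mul]
  · gcongr with j hj
    by_cases h : ∀ i < j, w i = 1
    · have : t ∈ cylAt m j x := fun i hi => eq_of_rad_mul_conj_eq_one hm i x t (h i hi)
      rw [if_pos h, if_pos this]
    · rw [if_neg h]; split_ifs <;> positivity

lemma measurable_of_forall_congr {β : Type*} [MeasurableSpace β] {g : Gm m → β} (n : ℕ)
    (h : ∀ x y : Gm m, (∀ k < n, x k = y k) → g x = g y) : Measurable g := by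
  have : ∀ k, Countable (ZMod k) := fun k => by cases k <;> (unfold ZMod; infer_instance)
  let res : Gm m → (∀ i : Fin n, ZMod (m i)) := fun x i => x i
  let ext : (∀ i : Fin n, ZMod (m i)) → Gm m := fun y k => if hk : k < n then y ⟨k, hk⟩ else 0
  have e : g = (g ∘ ext) ∘ res := by
    funext x
    refine h _ _ fun k hk => ?_
    simp [ext, res, hk]
  rw [e]
  have : ∀ k, MeasurableSingletonClass (ZMod k) := fun k => ⟨fun _ => trivial⟩
  exact (Measurable.of_discrete).comp (measurable_pi_lambda _ fun i => measurable_pi_apply _)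

lemma measurableSet_mem_cylAt (n : ℕ) :
    MeasurableSet {q : Gm m × Gm m | q.2 ∈ cylAt m n q.1} := by
  have hc : ∀ k, Countable (ZMod k) := fun k => by cases k <;> (unfold ZMod; infer_instance)
  have hs : ∀ k, MeasurableSingletonClass (ZMod k) := fun k => ⟨fun _ => trivial⟩
  have e : {q : Gm m × Gm m | q.2 ∈ cylAt m n q.1} =
      ⋂ k, ⋂ (_ : k < n), {q : Gm m × Gm m | q.2 k = q.1 k} := by
    ext q
    simp [cylAt]
  rw [e]
  refine MeasurableSet.iInter fun k => MeasurableSet.iInter fun _ => ?_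
  exact measurableSet_eq_fun (f := fun q : Gm m × Gm m => q.2 k) (g := fun q => q.1 k)
    ((measurable_pi_apply k).comp measurable_snd) ((measurable_pi_apply k).comp measurable_fst)

lemma measurableSet_cylAt (n : ℕ) (x : Gm m) : MeasurableSet (cylAt m n x) :=
  measurable_prodMk_left (measurableSet_mem_cylAt n)

lemma mem_cylAt_comm {n : ℕ} {x y : Gm m} : x ∈ cylAt m n y ↔ y ∈ cylAt m n x := by
  simp only [cylAt, Set.mem_ofPred_eq, eq_comm]

variable {μ : Measure (Gm m)}

lemma IsHaar.isProbabilityMeasure (hμ : IsHaar m μ) : IsProbabilityMeasure μ := by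
  constructor
  have := hμ 0 (fun _ => 0)
  simpa [cylAt, M] using this

lemma IsHaar.lintegral_setLIntegral_cylAt (hμ : IsHaar m μ) (n : ℕ) {g : Gm m → ℝ≥0∞}
    (hg : Measurable g) :
    ∫⁻ x, ∫⁻ t in cylAt m n x, g t ∂μ ∂μ = (M m n : ℝ≥0∞)⁻¹ * ∫⁻ t, g t ∂μ := by
  have := hμ.isProbabilityMeasure
  have e : ∀ x, ∫⁻ t in cylAt m n x, g t ∂μ = ∫⁻ t, (cylAt m n x).indicator g t ∂μ := fun x =>
    (lintegral_indicator (measurableSet_cylAt n x) g).symm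
  simp only [e]
  rw [lintegral_lintegral_swap, ← lintegral_const_mul _ hg]
  · refine lintegral_congr fun t => ?_
    have e2 : ∀ x, (cylAt m n x).indicator g t = (cylAt m n t).indicator (fun _ => g t) x := by
      intro x
      by_cases h : t ∈ cylAt m n x
      · rw [Set.indicator_of_mem h, Set.indicator_of_mem (mem_cylAt_comm.1 h)]
      · rw [Set.indicator_of_notMem h, Set.indicator_of_notMem (mt mem_cylAt_comm.1 h)]
    simp only [e2]
    rw [lintegral_indicator_const (measurableSet_cylAt n t), hμ, mul_comm]
  · exact ((hg.comp measurable_snd).indicator (measurableSet_mem_cylAt n)).aemeasurable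

lemma IsMartingale.integral_mul_eq (hm : ∀ k, 2 ≤ m k) (hμ : IsHaar m μ)
    {f : ℕ → Gm m → ℂ} (hf : IsMartingale m μ f)
    {n N : ℕ} (hn : n ≤ N) {h : Gm m → ℂ} (hh : ∀ x y : Gm m, (∀ k < n, x k = y k) → h x = h y)
    (h1 : ∀ x, ‖h x‖ ≤ 1) : ∫ x, f n x * h x ∂μ = ∫ x, f N x * h x ∂μ := by
  have := hμ.isProbabilityMeasure
  have hM : (M m n : ℂ) ≠ 0 := by exact_mod_cast (M_pos hm n).ne'
  have hint : Integrable (fun t => f N t * h t) μ :=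
    (hf.integrable N).mul_bdd (c := 1) (measurable_of_forall_congr n hh).aestronglyMeasurable
      (Filter.Eventually.of_forall h1)
  have e : ∀ x, f n x * h x =
      M m n * ∫ t, (cylAt m n x).indicator (fun t => f N t * h t) t ∂μ := by
    intro x
    rw [hf.mart n N hn x, mul_assoc, ← integral_mul_const,
      integral_indicator (measurableSet_cylAt n x)]
    congr 1
    refine setIntegral_congr_fun (measurableSet_cylAt n x) fun t ht => ?_
    rw [hh x t fun k hk => (ht k hk).symm]
  simp only [e]
  rw [integral_const_mul, integral_integral_swap, ← integral_const_mul]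
  · refine integral_congr_ae (Filter.Eventually.of_forall fun t => ?_)
    have e2 : ∀ x, (cylAt m n x).indicator (fun t => f N t * h t) t =
        (cylAt m n t).indicator (fun _ => f N t * h t) x := by
      intro x
      by_cases h : t ∈ cylAt m n x
      · rw [Set.indicator_of_mem h, Set.indicator_of_mem (mem_cylAt_comm.1 h)]
      · rw [Set.indicator_of_notMem h, Set.indicator_of_notMem (mt mem_cylAt_comm.1 h)]
    simp only [e2]
    rw [integral_indicator_const _ (measurableSet_cylAt n t), Measure.real, hμ]
    simp only [ENNReal.toReal_inv, ENNReal.toReal_natCast, Complex.real_smul, Complex.ofReal_inv,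
      Complex.ofReal_natCast]
    rw [mul_inv_cancel_left₀ hM]
  · exact (hint.comp_snd μ).indicator (measurableSet_mem_cylAt n)

lemma IsMartingale.coeff_eq (hm : ∀ k, 2 ≤ m k) (hμ : IsHaar m μ)
    {f : ℕ → Gm m → ℂ} (hf : IsMartingale m μ f) {N k : ℕ} (hk : k < M m N) :
    coeff m μ f k = ∫ x, f N x * (starRingEnd ℂ) (vil m k x) ∂μ := by
  have hk' : k < M m (k + 1) := (Nat.lt_succ_self k).trans (lt_M_self hm _)
  have h1 : ∀ x, ‖(starRingEnd ℂ) (vil m k x)‖ ≤ 1 := fun x => by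
    rw [RCLike.norm_conj, norm_vil]
  rcases le_total (k + 1) N with h | h
  · exact hf.integral_mul_eq hm hμ h (fun x y hxy => by rw [vil_congr hm hk' x y hxy]) h1
  · exact (hf.integral_mul_eq hm hμ h (fun x y hxy => by rw [vil_congr hm hk x y hxy]) h1).symm

lemma IsMartingale.S_eq_integral (hm : ∀ k, 2 ≤ m k) (hμ : IsHaar m μ)
    {f : ℕ → Gm m → ℂ} (hf : IsMartingale m μ f) {n N : ℕ} (hn : n < M m N) (x : Gm m) :
    S m μ f n x =
      ∫ t, f N t * ∑ k ∈ range n, (starRingEnd ℂ) (vil m k t) * vil m k x ∂μ := by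
  simp only [Finset.mul_sum, ← mul_assoc]
  rw [integral_finsetSum]
  · refine Finset.sum_congr rfl fun k hk => ?_
    rw [hf.coeff_eq hm hμ ((Finset.mem_range.1 hk).trans hn), integral_mul_const]
  · intro k hk
    refine Integrable.mul_const ((hf.integrable N).mul_bdd (c := 1) ?_
      (Filter.Eventually.of_forall fun t => by rw [RCLike.norm_conj, norm_vil])) _
    refine (measurable_of_forall_congr N fun x y hxy => ?_).aestronglyMeasurable
    rw [vil_congr hm ((Finset.mem_range.1 hk).trans hn) x y hxy]

lemma IsMartingale.enorm_S_le (hm : ∀ k, 2 ≤ m k) {lam : ℕ} (hlam : ∀ k, m k ≤ lam)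
    (hμ : IsHaar m μ) {f : ℕ → Gm m → ℂ} (hf : IsMartingale m μ f) {n N : ℕ} (hn : n < M m N)
    (x : Gm m) :
    ‖S m μ f n x‖ₑ ≤ lam * ∑ j ∈ range N, M m j * ∫⁻ t in cylAt m j x, ‖f N t‖ₑ ∂μ := by
  classical
  rw [hf.S_eq_integral hm hμ hn]
  refine (enorm_integral_le_lintegral_enorm _).trans ?_
  have hmeas : Measurable fun t => ‖f N t‖ₑ :=
    (measurable_of_forall_congr N (hf.adapted N)).enorm
  calc ∫⁻ t, ‖f N t * ∑ k ∈ range n, (starRingEnd ℂ) (vil m k t) * vil m k x‖ₑ ∂μ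
      ≤ ∫⁻ t, lam * ∑ j ∈ range N, M m j *
          (cylAt m j x).indicator (fun t => ‖f N t‖ₑ) t ∂μ := by
        refine lintegral_mono fun t => ?_
        have hk := ENNReal.ofReal_le_ofReal (norm_kernel_le hm hlam hn x t)
        rw [ofReal_norm, ENNReal.ofReal_mul (by positivity), ENNReal.ofReal_natCast,
          ENNReal.ofReal_sum_of_nonneg (fun j _ => by split_ifs <;> positivity)] at hk
        rw [enorm_mul]
        refine (mul_le_mul_right hk _).trans (le_of_eq ?_)
        rw [mul_left_comm, Finset.mul_sum]
        congr 1
        refine Finset.sum_congr rfl fun j _ => ?_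
        by_cases h : t ∈ cylAt m j x
        · simp [h, mul_comm]
        · simp [h]
    _ = _ := by
        rw [lintegral_const_mul, lintegral_finsetSum]
        · congr 1
          refine Finset.sum_congr rfl fun j _ => ?_
          rw [lintegral_const_mul, lintegral_indicator (measurableSet_cylAt j x)]
          exact hmeas.indicator (measurableSet_cylAt j x)
        · exact fun j _ => (hmeas.indicator (measurableSet_cylAt j x)).const_mul _
        · exact Finset.measurable_fun_sum _ fun j _ =>
            (hmeas.indicator (measurableSet_cylAt j x)).const_mul _

/-- Reverse Hölder inequality for functions of the first `N` coordinates. -/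
lemma IsHaar.lintegral_le_rpow (hm : ∀ k, 2 ≤ m k) (hμ : IsHaar m μ) {p : ℝ} (hp0 : 0 < p)
    (hp1 : p < 1) {N : ℕ} {g : Gm m → ℝ≥0∞}
    (hg : ∀ x y : Gm m, (∀ k < N, x k = y k) → g x = g y) :
    ∫⁻ t, g t ∂μ ≤ (M m N : ℝ≥0∞) ^ (1 / p - 1) * (∫⁻ t, g t ^ p ∂μ) ^ (1 / p) := by
  have hM0 : (M m N : ℝ≥0∞) ≠ 0 := by exact_mod_cast (M_pos hm N).ne'
  have hmeas : Measurable g := measurable_of_forall_congr N hg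
  have hq : 0 < 1 / p - 1 := by rw [sub_pos, lt_div_iff₀ hp0]; linarith
  set J := ∫⁻ t, g t ^ p ∂μ with hJ
  have hpt : ∀ x, g x ≤ (M m N * J) ^ (1 / p) := by
    intro x
    rw [one_div, ENNReal.le_rpow_inv_iff hp0]
    have h1 : ∫⁻ t in cylAt m N x, g t ^ p ∂μ = g x ^ p * (M m N : ℝ≥0∞)⁻¹ := by
      rw [setLIntegral_congr_fun (g := fun _ => g x ^ p) (measurableSet_cylAt N x)
        (fun t ht => by simp only; rw [hg t x ht]), setLIntegral_const, hμ]
    have h2 : g x ^ p * (M m N : ℝ≥0∞)⁻¹ ≤ J := h1 ▸ setLIntegral_le_lintegral _ _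
    rw [← div_eq_mul_inv, ENNReal.div_le_iff hM0 (ENNReal.natCast_ne_top _)] at h2
    rwa [mul_comm]
  calc ∫⁻ t, g t ∂μ ≤ ∫⁻ t, g t ^ p * ((M m N * J) ^ (1 / p)) ^ (1 - p) ∂μ := by
        refine lintegral_mono fun t => ?_
        calc g t = g t ^ (p + (1 - p)) := by simp
          _ = g t ^ p * g t ^ (1 - p) :=
            ENNReal.rpow_add_of_nonneg _ _ hp0.le (by linarith)
          _ ≤ _ := mul_le_mul_right (ENNReal.rpow_le_rpow (hpt t) (by linarith)) _
    _ = J * (M m N * J) ^ (1 / p - 1) := by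
        rw [lintegral_mul_const _ (hmeas.pow_const p), ← ENNReal.rpow_mul]
        congr 2
        field_simp
    _ = (M m N : ℝ≥0∞) ^ (1 / p - 1) * J ^ (1 / p) := by
        rw [ENNReal.mul_rpow_of_nonneg _ _ hq.le, mul_left_comm]
        congr 1
        conv_rhs => rw [show 1 / p = 1 + (1 / p - 1) by ring,
          ENNReal.rpow_add_of_nonneg _ _ zero_le_one hq.le, ENNReal.rpow_one]

lemma IsHaar.setLIntegral_cylAt_le_rpow (hm : ∀ k, 2 ≤ m k) (hμ : IsHaar m μ) {p : ℝ}
    (hp0 : 0 < p) (hp1 : p < 1) {j N : ℕ} (hj : j ≤ N) {g : Gm m → ℝ≥0∞}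
    (hg : ∀ x y : Gm m, (∀ k < N, x k = y k) → g x = g y) (x : Gm m) :
    ∫⁻ t in cylAt m j x, g t ∂μ ≤
      (M m N : ℝ≥0∞) ^ (1 / p - 1) * (∫⁻ t in cylAt m j x, g t ^ p ∂μ) ^ (1 / p) := by
  classical
  have key := hμ.lintegral_le_rpow hm hp0 hp1 (N := N) (g := (cylAt m j x).indicator g) ?_
  · have e : ∀ t, (cylAt m j x).indicator g t ^ p =
        (cylAt m j x).indicator (fun t => g t ^ p) t := by
      intro t
      by_cases h : t ∈ cylAt m j x <;> simp [h, hp0]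
    simp only [e] at key
    rwa [lintegral_indicator (measurableSet_cylAt j x),
      lintegral_indicator (measurableSet_cylAt j x)] at key
  · intro y z hyz
    have : y ∈ cylAt m j x ↔ z ∈ cylAt m j x :=
      forall₂_congr fun k hk => by rw [hyz k (hk.trans_le hj)]
    simp only [Set.indicator, this, hg y z hyz]

lemma exists_lt_M_le (hm : ∀ k, 2 ≤ m k) {lam : ℕ} (hlam : ∀ k, m k ≤ lam) (n : ℕ) :
    ∃ N, n < M m N ∧ M m N ≤ lam * (n + 1) := by
  classical
  have hex : ∃ N, n < M m N := ⟨n, lt_M_self hm n⟩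
  refine ⟨Nat.find hex, Nat.find_spec hex, ?_⟩
  rcases h : Nat.find hex with _ | k
  · have h1 := hm 0
    have h2 := hlam 0
    rw [M]
    nlinarith
  · have hk : M m k ≤ n := not_lt.1 (Nat.find_min hex (by omega))
    exact Nat.mul_le_mul (hlam k) (by omega)

lemma IsMartingale.weighted_S_rpow_le (hm : ∀ k, 2 ≤ m k) {lam : ℕ} (hlam : ∀ k, m k ≤ lam)
    (hμ : IsHaar m μ) {f : ℕ → Gm m → ℂ} (hf : IsMartingale m μ f) {p : ℝ} (hp0 : 0 < p)
    (hp1 : p < 1) (n : ℕ) (x : Gm m) :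
    (‖S m μ f n x‖ₑ / ((n + 1 : ℕ) : ℝ≥0∞) ^ (1 / p - 1)) ^ p ≤
      lam * ∑' j, (M m j : ℝ≥0∞) ^ p * ∫⁻ t in cylAt m j x, mstar m f t ^ p ∂μ := by
  obtain ⟨N, hnN, hN⟩ := exists_lt_M_le hm hlam n
  have hq : 0 < 1 / p - 1 := by rw [sub_pos, lt_div_iff₀ hp0]; linarith
  set A : ℕ → ℝ≥0∞ := fun j => ∫⁻ t in cylAt m j x, mstar m f t ^ p ∂μ with hA
  have hbound : ‖S m μ f n x‖ₑ / ((n + 1 : ℕ) : ℝ≥0∞) ^ (1 / p - 1) ≤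
      (lam : ℝ≥0∞) ^ (1 / p) * ∑ j ∈ range N, M m j * A j ^ (1 / p) := by
    refine ENNReal.div_le_of_le_mul ?_
    calc ‖S m μ f n x‖ₑ
        ≤ lam * ∑ j ∈ range N, M m j * ∫⁻ t in cylAt m j x, ‖f N t‖ₑ ∂μ :=
          hf.enorm_S_le hm hlam hμ hnN x
      _ ≤ lam * ∑ j ∈ range N, M m j *
            (((lam * (n + 1) : ℕ) : ℝ≥0∞) ^ (1 / p - 1) * A j ^ (1 / p)) := by
          gcongr with j hj
          refine (hμ.setLIntegral_cylAt_le_rpow hm hp0 hp1 (Finset.mem_range.1 hj).le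
            (fun y z hyz => by rw [hf.adapted N y z hyz]) x).trans ?_
          gcongr
          refine lintegral_mono fun t => ENNReal.rpow_le_rpow ?_ hp0.le
          exact le_iSup (fun n => (‖f n t‖₊ : ℝ≥0∞)) N
      _ = _ := by
          rw [Nat.cast_mul, ENNReal.mul_rpow_of_nonneg _ _ hq.le,
            show 1 / p = 1 + (1 / p - 1) by ring,
            ENNReal.rpow_add_of_nonneg (x := (lam : ℝ≥0∞)) _ _ zero_le_one hq.le,
            ENNReal.rpow_one, ← show 1 / p = 1 + (1 / p - 1) by ring]
          simp only [Finset.mul_sum, Finset.sum_mul]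
          refine Finset.sum_congr rfl fun j _ => ?_
          ring
  have hinv : ∀ a : ℝ≥0∞, (a ^ (1 / p)) ^ p = a := fun a => by
    rw [← ENNReal.rpow_mul, one_div_mul_cancel hp0.ne', ENNReal.rpow_one]
  refine (ENNReal.rpow_le_rpow hbound hp0.le).trans ?_
  rw [ENNReal.mul_rpow_of_nonneg _ _ hp0.le, hinv]
  gcongr
  calc (∑ j ∈ range N, M m j * A j ^ (1 / p)) ^ p
      ≤ ∑ j ∈ range N, (M m j * A j ^ (1 / p)) ^ p :=
        Finset.le_sum_of_subadditive (fun a : ℝ≥0∞ => a ^ p)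
          (ENNReal.zero_rpow_of_pos hp0).le
          (fun a b => ENNReal.rpow_add_le_add_rpow a b hp0.le hp1.le) _ _
    _ = ∑ j ∈ range N, (M m j : ℝ≥0∞) ^ p * A j :=
        Finset.sum_congr rfl fun j _ => by
          rw [ENNReal.mul_rpow_of_nonneg _ _ hp0.le, hinv]
    _ ≤ _ := ENNReal.sum_le_tsum _

lemma M_rpow_mul_inv_le (hm : ∀ k, 2 ≤ m k) {p : ℝ} (hp1 : p < 1) (j : ℕ) :
    (M m j : ℝ≥0∞) ^ p * (M m j : ℝ≥0∞)⁻¹ ≤ ((2 : ℝ≥0∞) ^ (p - 1)) ^ j := by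
  have hM0 : (M m j : ℝ≥0∞) ≠ 0 := by exact_mod_cast (M_pos hm j).ne'
  rw [← ENNReal.rpow_neg_one, ← ENNReal.rpow_add _ _ hM0 (ENNReal.natCast_ne_top _),
    ← sub_eq_add_neg, ← ENNReal.rpow_natCast, ← ENNReal.rpow_mul, mul_comm, ENNReal.rpow_mul,
    ENNReal.rpow_natCast]
  rw [← neg_sub, ENNReal.rpow_neg, ENNReal.rpow_neg, ENNReal.inv_le_inv]
  exact ENNReal.rpow_le_rpow (by exact_mod_cast two_pow_le_M hm j) (by linarith)

lemma IsMartingale.lintegral_weighted_maximal_le (hm : ∀ k, 2 ≤ m k) {lam : ℕ}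
    (hlam : ∀ k, m k ≤ lam) (hμ : IsHaar m μ) {f : ℕ → Gm m → ℂ} (hf : IsMartingale m μ f)
    {p : ℝ} (hp0 : 0 < p) (hp1 : p < 1) :
    ∫⁻ x, (⨆ n : ℕ, (‖S m μ f n x‖₊ : ℝ≥0∞) / ((n + 1 : ℕ) : ℝ≥0∞) ^ (1 / p - 1)) ^ p ∂μ ≤
      lam * (1 - (2 : ℝ≥0∞) ^ (p - 1))⁻¹ * ∫⁻ x, mstar m f x ^ p ∂μ := by
  have := hμ.isProbabilityMeasure
  have hmeas : Measurable fun x => mstar m f x ^ p :=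
    (Measurable.iSup fun n =>
      (measurable_of_forall_congr n (hf.adapted n)).nnnorm.coe_nnreal_ennreal).pow_const p
  have hA : ∀ j, Measurable fun x => ∫⁻ t in cylAt m j x, mstar m f t ^ p ∂μ := fun j => by
    simp only [← lintegral_indicator (measurableSet_cylAt j _)]
    exact Measurable.lintegral_prod_right'
      ((hmeas.comp measurable_snd).indicator (measurableSet_mem_cylAt j))
  have hB : ∀ j, Measurable fun x =>
      (M m j : ℝ≥0∞) ^ p * ∫⁻ t in cylAt m j x, mstar m f t ^ p ∂μ := fun j => (hA j).const_mul _
  calc _ ≤ ∫⁻ x, lam * ∑' j, (M m j : ℝ≥0∞) ^ p *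
        ∫⁻ t in cylAt m j x, mstar m f t ^ p ∂μ ∂μ := by
        refine lintegral_mono fun x => ?_
        rw [← ENNReal.le_rpow_inv_iff hp0]
        refine iSup_le fun n => ?_
        rw [ENNReal.le_rpow_inv_iff hp0]
        exact hf.weighted_S_rpow_le hm hlam hμ hp0 hp1 n x
    _ = lam * ∑' j, (M m j : ℝ≥0∞) ^ p * ((M m j : ℝ≥0∞)⁻¹ * ∫⁻ x, mstar m f x ^ p ∂μ) := by
        rw [lintegral_const_mul _ (Measurable.tsum hB),
          lintegral_tsum fun j => (hB j).aemeasurable]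
        simp only [lintegral_const_mul _ (hA _), hμ.lintegral_setLIntegral_cylAt _ hmeas]
    _ ≤ lam * ∑' j, ((2 : ℝ≥0∞) ^ (p - 1)) ^ j * ∫⁻ x, mstar m f x ^ p ∂μ := by
        simp only [← mul_assoc]
        gcongr with j
        exact M_rpow_mul_inv_le hm hp1 j
    _ = _ := by rw [ENNReal.tsum_mul_right, ENNReal.tsum_geometric, mul_assoc]

end Vilenkin

/-- for `0 < p < 1` there is `c_p > 0` (depending only on `p` and
`λ = sup m_k`) with `‖ sup_n |S_n f|/(n+1)^{1/p-1} ‖_{L_p} ≤ c_p ‖f‖_{H_p}` for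
every martingale `f ∈ H_p`. -/
theorem statement9 (p : ℝ) (hp0 : 0 < p) (hp1 : p < 1) (lam : ℕ) :
    ∃ c : ℝ, 0 < c ∧
      ∀ (m : ℕ → ℕ), (∀ k, 2 ≤ m k) → (∀ k, m k ≤ lam) →
      ∀ (μ : Measure (Gm m)), Vilenkin.IsHaar m μ →
      ∀ (f : ℕ → Gm m → ℂ), Vilenkin.IsMartingale m μ f → Vilenkin.MemHp m μ p f →
        Vilenkin.eLp m μ p (fun x => ⨆ n : ℕ,
            (‖Vilenkin.S m μ f n x‖₊ : ℝ≥0∞) / ((n + 1 : ℕ) : ℝ≥0∞) ^ (1 / p - 1)) ≤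
          ENNReal.ofReal c * Vilenkin.eLp m μ p (Vilenkin.mstar m f) := by
  have h2 : (2 : ℝ≥0∞) ^ (p - 1) < 1 :=
    ENNReal.rpow_lt_one_of_one_lt_of_neg (by norm_num) (by linarith)
  set C : ℝ≥0∞ := (lam + 1) * (1 - (2 : ℝ≥0∞) ^ (p - 1))⁻¹ with hC
  have hCtop : C ≠ ⊤ := ENNReal.mul_ne_top (by finiteness)
    (ENNReal.inv_ne_top.2 (tsub_pos_of_lt h2).ne')
  have hC0 : C ≠ 0 := mul_ne_zero (by simp)
    (ENNReal.inv_ne_zero.2 (ne_top_of_le_ne_top ENNReal.one_ne_top tsub_le_self))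
  have hC' : C ^ (1 / p) ≠ ⊤ := ENNReal.rpow_ne_top_of_nonneg (by positivity) hCtop
  refine ⟨(C ^ (1 / p)).toReal, ENNReal.toReal_pos (ENNReal.rpow_pos_of_nonneg
    (pos_iff_ne_zero.2 hC0) (by positivity)).ne' hC', ?_⟩
  intro m hm hlam μ hμ f hf _
  rw [ENNReal.ofReal_toReal hC', Vilenkin.eLp, Vilenkin.eLp,
    ← ENNReal.mul_rpow_of_nonneg _ _ (by positivity)]
  refine ENNReal.rpow_le_rpow ?_ (by positivity)
  refine (hf.lintegral_weighted_maximal_le hm hlam hμ hp0 hp1).trans ?_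
  rw [hC]
  gcongr
  exact le_self_add
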